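/- arXiv:1405.1202 — 3 statements merged into one kernel-verified Lean document; each statement's English description precedes it below -/
import Mathlib

section
/- Let β, χ : ℂ × ℝ → ℂ be functions of (ξ, φ), ξ = x¹ + ix², with χ twice continuously differentiable satisfying ∂_ξ̄ χ = β̄ ∂_φ χ (i.e. ∂̄χ = 0 with ∂̄ = ∂_ξ̄ − β̄∂_φ), and let h : ℂ × ℂ → ℂ be holomorphic in both variables. Then U₀(ξ, φ) = (∂_φ χ)(ξ, φ) · h(ξ, χ(ξ, φ)) satisfies the homogeneous equation ∂_ξ̄ U₀ − ∂_φ( β̄ U₀ ) = 0. -/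
open Complex

/-- Partial derivative in `x¹`, where `ξ = x¹ + ix²`. -/
noncomputable def dx1 (f : ℂ × ℝ → ℂ) (p : ℂ × ℝ) : ℂ :=
  deriv (fun t : ℝ => f (p.1 + (t : ℂ), p.2)) 0

/-- Partial derivative in `x²`, where `ξ = x¹ + ix²`. -/
noncomputable def dx2 (f : ℂ × ℝ → ℂ) (p : ℂ × ℝ) : ℂ :=
  deriv (fun t : ℝ => f (p.1 + (t : ℂ) * Complex.I, p.2)) 0

/-- Partial derivative in `φ`. -/
noncomputable def dphi (f : ℂ × ℝ → ℂ) (p : ℂ × ℝ) : ℂ :=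
  deriv (fun s : ℝ => f (p.1, s)) p.2

/-- Wirtinger derivative `∂_ξ̄ = ½(∂_{x¹} + i ∂_{x²})`. -/
noncomputable def dbar (f : ℂ × ℝ → ℂ) (p : ℂ × ℝ) : ℂ :=
  (dx1 f p + Complex.I * dx2 f p) / 2

theorem HasFDerivAt.dx1_eq {f : ℂ × ℝ → ℂ} {p : ℂ × ℝ} {f' : ℂ × ℝ →L[ℝ] ℂ}
    (hf : HasFDerivAt f f' p) : dx1 f p = f' (1, 0) := by
  have hc : HasDerivAt (fun t : ℝ => ((p.1 + (t : ℂ), p.2) : ℂ × ℝ)) (1, 0) 0 :=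
    (Complex.ofRealCLM.hasDerivAt.const_add p.1).prodMk (hasDerivAt_const _ _)
  exact (HasFDerivAt.comp_hasDerivAt (0 : ℝ) (by simpa using hf) hc).deriv

theorem HasFDerivAt.dx2_eq {f : ℂ × ℝ → ℂ} {p : ℂ × ℝ} {f' : ℂ × ℝ →L[ℝ] ℂ}
    (hf : HasFDerivAt f f' p) : dx2 f p = f' (Complex.I, 0) := by
  have hc : HasDerivAt (fun t : ℝ => ((p.1 + (t : ℂ) * Complex.I, p.2) : ℂ × ℝ))
      (Complex.I, 0) 0 := by
    simpa using ((Complex.ofRealCLM.hasDerivAt.mul_const Complex.I).const_add p.1).prodMk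
      (hasDerivAt_const (0 : ℝ) p.2)
  exact (HasFDerivAt.comp_hasDerivAt (0 : ℝ) (by simpa using hf) hc).deriv

theorem HasFDerivAt.dphi_eq {f : ℂ × ℝ → ℂ} {p : ℂ × ℝ} {f' : ℂ × ℝ →L[ℝ] ℂ}
    (hf : HasFDerivAt f f' p) : dphi f p = f' (0, 1) :=
  (HasFDerivAt.comp_hasDerivAt p.2 hf
    ((hasDerivAt_const p.2 p.1).prodMk (hasDerivAt_id p.2))).deriv

theorem HasFDerivAt.dbar_eq {f : ℂ × ℝ → ℂ} {p : ℂ × ℝ} {f' : ℂ × ℝ →L[ℝ] ℂ}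
    (hf : HasFDerivAt f f' p) :
    dbar f p = (f' (1, 0) + Complex.I * f' (Complex.I, 0)) / 2 := by
  rw [dbar, hf.dx1_eq, hf.dx2_eq]

theorem HasFDerivAt.dbar_mul {f g : ℂ × ℝ → ℂ} {p : ℂ × ℝ} {f' g' : ℂ × ℝ →L[ℝ] ℂ}
    (hf : HasFDerivAt f f' p) (hg : HasFDerivAt g g' p) :
    dbar (fun q => f q * g q) p = dbar f p * g p + f p * dbar g p := by
  rw [(hf.fun_mul hg).dbar_eq, hf.dbar_eq, hg.dbar_eq]
  simp only [add_apply, smul_apply, smul_eq_mul]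
  ring

theorem HasFDerivAt.dphi_mul {f g : ℂ × ℝ → ℂ} {p : ℂ × ℝ} {f' g' : ℂ × ℝ →L[ℝ] ℂ}
    (hf : HasFDerivAt f f' p) (hg : HasFDerivAt g g' p) :
    dphi (fun q => f q * g q) p = dphi f p * g p + f p * dphi g p := by
  rw [(hf.fun_mul hg).dphi_eq, hf.dphi_eq, hg.dphi_eq]
  simp only [add_apply, smul_apply, smul_eq_mul]
  ring

/-- The chain rule for a holomorphic function of `ξ` and `χ`: the antiholomorphic derivative
sees only the second argument. -/
theorem exists_hasFDerivAt_comp_holomorphic {h : ℂ → ℂ → ℂ}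
    (hh : Differentiable ℂ (fun q : ℂ × ℂ => h q.1 q.2)) {χ : ℂ × ℝ → ℂ} {p : ℂ × ℝ}
    (hχ : DifferentiableAt ℝ χ p) :
    ∃ (g' : ℂ × ℝ →L[ℝ] ℂ) (c : ℂ), HasFDerivAt (fun q : ℂ × ℝ => h q.1 (χ q)) g' p ∧
      dbar (fun q : ℂ × ℝ => h q.1 (χ q)) p = c * dbar χ p ∧
      dphi (fun q : ℂ × ℝ => h q.1 (χ q)) p = c * dphi χ p := by
  have hL := hχ.hasFDerivAt
  set L := fderiv ℝ χ p
  have hH := (hh (p.1, χ p)).hasFDerivAt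
  set H := fderiv ℂ (fun q : ℂ × ℂ => h q.1 q.2) (p.1, χ p)
  have hlin : ∀ a b : ℂ, H (a, b) = a * H (1, 0) + b * H (0, 1) := fun a b => by
    rw [← smul_eq_mul, ← smul_eq_mul, ← map_smul, ← map_smul, ← map_add]
    simp
  have hg : HasFDerivAt (fun q : ℂ × ℝ => h q.1 (χ q))
      ((H.restrictScalars ℝ).comp ((ContinuousLinearMap.fst ℝ ℂ ℝ).prod L)) p :=
    HasFDerivAt.comp (g := fun q : ℂ × ℂ => h q.1 q.2) p (hH.restrictScalars ℝ)
      (hasFDerivAt_fst.prodMk hL)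
  refine ⟨_, H (0, 1), hg, ?_, ?_⟩
  · rw [hg.dbar_eq, hL.dbar_eq]
    simp only [ContinuousLinearMap.comp_apply, ContinuousLinearMap.prod_apply,
      ContinuousLinearMap.coe_fst', ContinuousLinearMap.coe_restrictScalars']
    rw [hlin 1, hlin Complex.I]
    linear_combination H (1, 0) / 2 * Complex.I_mul_I
  · rw [hg.dphi_eq, hL.dphi_eq]
    simp only [ContinuousLinearMap.comp_apply, ContinuousLinearMap.prod_apply,
      ContinuousLinearMap.coe_fst', ContinuousLinearMap.coe_restrictScalars']
    rw [hlin 0]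
    ring

theorem ContDiff.hasFDerivAt_fderiv_apply {χ : ℂ × ℝ → ℂ} (hχ : ContDiff ℝ 2 χ)
    (p v : ℂ × ℝ) :
    HasFDerivAt (fun q => fderiv ℝ χ q v) ((fderiv ℝ (fderiv ℝ χ) p).flip v) p := by
  have hd : DifferentiableAt ℝ (fderiv ℝ χ) p :=
    (hχ.fderiv_right (m := 1) (by norm_num)).differentiable (by norm_num) p
  simpa using hd.hasFDerivAt.clm_apply (hasFDerivAt_const v p)

theorem ContDiff.exists_hasFDerivAt_dphi {χ : ℂ × ℝ → ℂ} (hχ : ContDiff ℝ 2 χ) (p : ℂ × ℝ) :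
    ∃ a b : ℂ × ℝ →L[ℝ] ℂ, HasFDerivAt (dphi χ) a p ∧ HasFDerivAt (dbar χ) b p ∧
      dbar (dphi χ) p = dphi (dbar χ) p := by
  have hd : ∀ q, HasFDerivAt χ (fderiv ℝ χ q) q := fun q =>
    (hχ.differentiable (by norm_num) q).hasFDerivAt
  have ha : HasFDerivAt (dphi χ) _ p :=
    (hχ.hasFDerivAt_fderiv_apply p (0, 1)).congr_of_eventuallyEq
      (.of_forall fun q => (hd q).dphi_eq)
  have hb : HasFDerivAt (dbar χ) _ p :=
    (((hχ.hasFDerivAt_fderiv_apply p (1, 0)).add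
      ((hχ.hasFDerivAt_fderiv_apply p (Complex.I, 0)).const_mul Complex.I)).mul_const
        (2⁻¹ : ℂ)).congr_of_eventuallyEq
      (.of_forall fun q => by simp [(hd q).dbar_eq, div_eq_mul_inv])
  refine ⟨_, _, ha, hb, ?_⟩
  have hs : IsSymmSndFDerivAt ℝ χ p := hχ.contDiffAt.isSymmSndFDerivAt (by simp)
  rw [ha.dbar_eq, hb.dphi_eq]
  simp only [ContinuousLinearMap.flip_apply, add_apply, smul_apply, smul_eq_mul]
  rw [hs.eq (1, 0), hs.eq (Complex.I, 0)]
  ring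

/-- if `χ` is a CR function (`∂_ξ̄χ = β̄∂_φχ`) and `h(·,·)` is holomorphic
in both variables, then `U₀ = χ_{,φ}·h(ξ, χ)` solves the homogeneous tangential
Cauchy–Riemann equation (37a), `∂_ξ̄U₀ − ∂_φ(β̄U₀) = 0`. -/
theorem free_term_solves_homogeneous_CR
    (β χ : ℂ × ℝ → ℂ) (hχ : ContDiff ℝ 2 χ)
    (hCR : ∀ p : ℂ × ℝ, dbar χ p = (starRingEnd ℂ) (β p) * dphi χ p)
    (h : ℂ → ℂ → ℂ) (hh : Differentiable ℂ (fun q : ℂ × ℂ => h q.1 q.2))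
    (U₀ : ℂ × ℝ → ℂ)
    (hU₀ : ∀ p : ℂ × ℝ, U₀ p = dphi χ p * h p.1 (χ p)) :
    ∀ p : ℂ × ℝ,
      dbar U₀ p - dphi (fun q => (starRingEnd ℂ) (β q) * U₀ q) p = 0 := by
  intro p
  obtain ⟨a, b, ha, hb, hab⟩ := hχ.exists_hasFDerivAt_dphi p
  obtain ⟨g', c, hg, hgbar, hgphi⟩ :=
    exists_hasFDerivAt_comp_holomorphic hh (hχ.differentiable (by norm_num) p)
  have hβU : (fun q => (starRingEnd ℂ) (β q) * U₀ q) = fun q => dbar χ q * h q.1 (χ q) := by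
    funext q
    rw [hU₀, hCR, mul_assoc]
  rw [hβU, funext hU₀, ha.dbar_mul hg, hb.dphi_mul hg, hab, hgbar, hgphi]
  ring
end

section
/- Let β : ℂ → ℂ be continuous (independent of φ), and let χ⁰ : ℂ → ℂ be continuously differentiable with ∂_ξ̄ χ⁰ = β̄. Let F : ℂ × ℂ → ℂ be continuously differentiable, compactly supported in its first variable, and holomorphic in its second variable. Define, for ξ ∈ ℂ and φ ∈ ℝ, U(ξ, φ) = (1/2πi) ∫_ℂ F(ξ′, φ + χ⁰(ξ) − χ⁰(ξ′)) / (ξ′ − ξ) dξ′∧dξ̄′ (the integral taken with respect to area measure, (1/2πi)dξ′∧dξ̄′ = −(1/π)dA). Then U satisfies ∂_ξ̄ U − β̄ ∂_φ U = F(ξ, φ), where ∂_ξ̄ = ½(∂_{x¹} + i∂_{x²}) is the Wirtinger derivative in ξ = x¹ + ix² and ∂_φ F(ξ′, ·) is computed via the holomorphic derivative in the second argument. -/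
open Complex MeasureTheory Real

/-- Wirtinger derivative `∂_ξ̄` for a function of `ξ = x¹ + ix²` alone. -/
noncomputable def dbarC (f : ℂ → ℂ) (z : ℂ) : ℂ :=
  (deriv (fun t : ℝ => f (z + (t : ℂ))) 0
    + Complex.I * deriv (fun t : ℝ => f (z + (t : ℂ) * Complex.I)) 0) / 2

theorem ContinuousLinearMap.apply_add_I_mul_apply_I_mul (L : ℂ →L[ℝ] ℂ) (z : ℂ) :
    L z + I * L (I * z) = (starRingEnd ℂ) z * (L 1 + I * L I) := by
  have key : ∀ w : ℂ, L w = w.re * L 1 + w.im * L I := fun w => by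
    conv_lhs => rw [show w = w.re • (1 : ℂ) + w.im • I by simp [Complex.re_add_im]]
    rw [map_add, L.map_smul, L.map_smul, Complex.real_smul, Complex.real_smul]
  have hz : (starRingEnd ℂ) z = z.re - z.im * I := by
    apply Complex.ext <;> simp
  rw [key z, key (I * z), hz]
  simp only [Complex.I_mul_re, Complex.I_mul_im, Complex.ofReal_neg]
  linear_combination ((z.im : ℂ) * L I) * I_sq

theorem integrableOn_polarCoord_target_of_forall_eq_zero {f : ℝ × ℝ → ℂ}
    (hf : Continuous f) {R : ℝ}
    (hR : ∀ p : ℝ × ℝ, R < p.1 → f p = 0) :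
    IntegrableOn f (Set.Ioi 0 ×ˢ Set.Ioo (-π) π) := by
  have h : IntegrableOn f (Set.Icc 0 R ×ˢ Set.Icc (-π) π) :=
    hf.continuousOn.integrableOn_compact (isCompact_Icc.prod isCompact_Icc)
  refine h.of_forall_sdiff_eq_zero (measurableSet_Ioi.prod measurableSet_Ioo) ?_
  rintro ⟨r, θ⟩ ⟨⟨hr, hθ⟩, hn⟩
  refine hR _ ?_
  by_contra! hle
  exact hn ⟨⟨le_of_lt hr, hle⟩, ⟨hθ.1.le, hθ.2.le⟩⟩

/-- The Cauchy–Pompeiu formula for compactly supported functions, at the origin. -/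
theorem integral_inv_mul_fderiv_wirtinger {g : ℂ → ℂ} (hg : ContDiff ℝ 1 g)
    (hc : HasCompactSupport g) :
    ∫ w : ℂ, w⁻¹ * ((fderiv ℝ g w 1 + I * fderiv ℝ g w I) / 2) = -π * g 0 := by
  set e : ℝ → ℂ := fun θ => cexp (θ * I) with he
  have hecont : Continuous e := by fun_prop
  have hnorm : ∀ θ, ‖e θ‖ = 1 := fun θ => Complex.norm_exp_ofReal_mul_I θ
  have hconj : ∀ θ, (e θ)⁻¹ = (starRingEnd ℂ) (e θ) := fun θ => by
    rw [Complex.inv_def, Complex.normSq_eq_norm_sq, hnorm]; simp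
  have hDcont : Continuous (fderiv ℝ g) := hg.continuous_fderiv one_ne_zero
  have hdiff : Differentiable ℝ g := hg.differentiable one_ne_zero
  obtain ⟨R, hR⟩ := hc.isCompact.isBounded.subset_closedBall 0
  have hDzero : ∀ w : ℂ, R < ‖w‖ → fderiv ℝ g w = 0 := fun w hw => by
    by_contra h
    have := hR (support_fderiv_subset ℝ h)
    simp at this
    linarith
  set P : ℝ × ℝ → ℂ := fun p => fderiv ℝ g (p.1 * e p.2) (e p.2)
  set Q : ℝ × ℝ → ℂ := fun p => fderiv ℝ g (p.1 * e p.2) (I * e p.2)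
  have hPc : Continuous P := by
    have : Continuous fun p : ℝ × ℝ => fderiv ℝ g (p.1 * e p.2) := by fun_prop
    exact this.clm_apply (by fun_prop)
  have hQc : Continuous Q := by
    have : Continuous fun p : ℝ × ℝ => fderiv ℝ g (p.1 * e p.2) := by fun_prop
    exact this.clm_apply (by fun_prop)
  have hlarge : ∀ p : ℝ × ℝ, R < p.1 → R < ‖(p.1 : ℂ) * e p.2‖ := fun p hp => by
    rw [norm_mul, hnorm, mul_one, Complex.norm_real]
    exact hp.trans_le (le_abs_self _)
  have hPi := integrableOn_polarCoord_target_of_forall_eq_zero hPc (R := R)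
    fun p hp => by simp [P, hDzero _ (hlarge p hp)]
  have hQi := integrableOn_polarCoord_target_of_forall_eq_zero hQc (R := R)
    fun p hp => by simp [Q, hDzero _ (hlarge p hp)]
  have hP : ∫ p in Set.Ioi 0 ×ˢ Set.Ioo (-π) π, P p = -(2 * π) * g 0 := by
    rw [Measure.volume_eq_prod, ← setIntegral_prod_swap, setIntegral_prod]
    rotate_left
    · rw [Measure.volume_eq_prod, IntegrableOn, ← Measure.prod_restrict] at hPi
      rw [IntegrableOn, ← Measure.prod_restrict]
      exact hPi.swap
    have hr : ∀ θ : ℝ, ∫ r in Set.Ioi (0 : ℝ), P (r, θ) = - g 0 := fun θ => by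
      have hd : ∀ r : ℝ, HasDerivAt (fun r : ℝ => g (r * e θ)) (P (r, θ)) r := fun r => by
        have h1 : HasDerivAt (fun r : ℝ => (r : ℂ) * e θ) (e θ) r := by
          simpa using (Complex.ofRealCLM.hasDerivAt (x := r)).mul_const (e θ)
        exact (hdiff _).hasFDerivAt.comp_hasDerivAt r h1
      have hcd : ContDiff ℝ 1 fun r : ℝ => g (r * e θ) :=
        hg.comp (Complex.ofRealCLM.contDiff.mul contDiff_const)
      have hcs : HasCompactSupport fun r : ℝ => g (r * e θ) := by
        refine HasCompactSupport.intro (isCompact_Icc (a := -R) (b := R)) fun r hr => ?_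
        by_contra h
        have := hR (subset_tsupport g h)
        rw [mem_closedBall_zero_iff, norm_mul, hnorm, mul_one, Complex.norm_real] at this
        exact hr (abs_le.1 this)
      have := hcs.integral_Ioi_deriv_eq hcd 0
      simpa [(funext fun r => (hd r).deriv : deriv (fun r : ℝ => g (r * e θ)) = _)] using this
    simp only [Prod.swap_prod_mk, hr, setIntegral_const]
    simp [Measure.real, two_mul, Real.pi_pos.le]
    ring
  have hQ : ∫ p in Set.Ioi 0 ×ˢ Set.Ioo (-π) π, Q p = 0 := by
    rw [Measure.volume_eq_prod, setIntegral_prod _ hQi]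
    refine setIntegral_eq_zero_of_forall_eq_zero fun r hr => ?_
    have hr0 : (r : ℂ) ≠ 0 := by exact_mod_cast (ne_of_gt hr)
    have hd : ∀ θ : ℝ, HasDerivAt (fun θ : ℝ => g (r * e θ)) (r * Q (r, θ)) θ := fun θ => by
      have h1 : HasDerivAt (fun θ : ℝ => (r : ℂ) * e θ) (r • (I * e θ)) θ := by
        have h2 : HasDerivAt (fun θ : ℝ => (θ : ℂ) * I) I θ := by
          simpa using (Complex.ofRealCLM.hasDerivAt (x := θ)).mul_const I
        simpa [he, mul_comm I] using h2.cexp.const_mul (r : ℂ)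
      have h3 := (hdiff _).hasFDerivAt.comp_hasDerivAt θ h1
      rwa [ContinuousLinearMap.map_smul, Complex.real_smul] at h3
    have hint := intervalIntegral.integral_eq_sub_of_hasDerivAt (a := -π) (b := π)
      (fun θ _ => hd θ)
      ((by fun_prop : Continuous fun θ : ℝ => (r : ℂ) * Q (r, θ)).intervalIntegrable _ _)
    have hends : e π = e (-π) := by simp [he, Complex.exp_neg]
    rw [hends, sub_self, intervalIntegral.integral_const_mul,
      intervalIntegral.integral_of_le (by linarith [Real.pi_pos]),
      integral_Ioc_eq_integral_Ioo] at hint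
    exact (mul_eq_zero.1 hint).resolve_left hr0
  rw [← Complex.integral_comp_polarCoord_symm]
  have hcongr : ∀ p ∈ polarCoord.target,
      p.1 • ((Complex.polarCoord.symm p)⁻¹ *
        ((fderiv ℝ g (Complex.polarCoord.symm p) 1
          + I * fderiv ℝ g (Complex.polarCoord.symm p) I) / 2))
        = (1 / 2) * P p + I / 2 * Q p := fun p hp => by
    have hr0 : (p.1 : ℂ) ≠ 0 := by exact_mod_cast (ne_of_gt hp.1)
    have hs : Complex.polarCoord.symm p = p.1 * e p.2 := by
      simp [he, Complex.exp_mul_I]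
    have := (fderiv ℝ g (p.1 * e p.2)).apply_add_I_mul_apply_I_mul (e p.2)
    rw [hs, mul_inv, hconj, Complex.real_smul]
    calc _ = (p.1 : ℂ) * (p.1 : ℂ)⁻¹ * ((starRingEnd ℂ) (e p.2) *
          (fderiv ℝ g (p.1 * e p.2) 1 + I * fderiv ℝ g (p.1 * e p.2) I)) / 2 := by ring
      _ = _ := by
        rw [← this, mul_inv_cancel₀ hr0]
        simp only [P, Q]
        ring
  rw [setIntegral_congr_fun polarCoord.open_target.measurableSet hcongr, polarCoord_target,
    integral_add (hPi.const_mul _) (hQi.const_mul _), integral_const_mul, integral_const_mul,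
    hP, hQ]
  ring

theorem integrable_indicator_closedBall_mul_norm_inv (C R : ℝ) :
    Integrable ((Metric.closedBall (0 : ℂ) R).indicator fun w : ℂ => C * ‖w‖⁻¹) := by
  rw [integrable_indicator_iff measurableSet_closedBall]
  have h : IntegrableOn (fun w : ℂ => C * ‖w‖⁻¹) (Metric.ball 0 (R + 1)) := by
    rw [integrableOn_fun_norm_addHaar volume (f := fun y => C * y⁻¹)]
    have : IntegrableOn (fun _ : ℝ => C) (Set.Ioo 0 (R + 1)) :=
      integrableOn_const (by simp)
    refine this.congr_fun (fun y hy => ?_) measurableSet_Ioo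
    have : y ≠ 0 := ne_of_gt hy.1
    simp [Complex.finrank_real_complex]
    field_simp
  exact h.mono_set (Metric.closedBall_subset_ball (by linarith))

theorem exists_norm_inv_smul_translate_le {E : Type*} [NormedAddCommGroup E] [NormedSpace ℂ E]
    {Φ : ℂ × ℂ → E} (hΦ : Continuous Φ) {R : ℝ} (hR : ∀ q : ℂ × ℂ, R < ‖q.1‖ → Φ q = 0)
    (p : ℂ × ℂ) :
    ∃ C S : ℝ, ∀ x ∈ Metric.ball p 1, ∀ w : ℂ, ‖w⁻¹ • Φ (x.1 + w, x.2)‖ ≤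
      (Metric.closedBall (0 : ℂ) S).indicator (fun w : ℂ => C * ‖w‖⁻¹) w := by
  obtain ⟨C, hC⟩ := ((isCompact_closedBall (0 : ℂ) R).prod
    (isCompact_closedBall p.2 1)).exists_bound_of_continuousOn hΦ.continuousOn
  refine ⟨|C|, R + (‖p.1‖ + 1), fun x hx w => ?_⟩
  rw [← ball_prod_same] at hx
  have hx1 : ‖x.1‖ ≤ ‖p.1‖ + 1 := by
    have := mem_ball_iff_norm.1 hx.1
    have := norm_le_norm_add_norm_sub' x.1 p.1
    linarith
  by_cases hxw : R < ‖x.1 + w‖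
  · rw [hR _ hxw, smul_zero, norm_zero]
    refine Set.indicator_apply_nonneg fun _ => ?_
    positivity
  · push Not at hxw
    have hw : w ∈ Metric.closedBall (0 : ℂ) (R + (‖p.1‖ + 1)) := by
      rw [mem_closedBall_zero_iff]
      have := norm_sub_le (x.1 + w) x.1
      rw [add_sub_cancel_left] at this
      linarith
    rw [Set.indicator_of_mem hw, norm_smul, norm_inv, mul_comm]
    gcongr
    refine le_trans (hC _ ⟨by simpa using hxw, Metric.ball_subset_closedBall hx.2⟩) (le_abs_self C)

/-- Differentiation of the Cauchy transform of a compactly supported function depending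
continuously differentiably on a parameter. -/
theorem hasFDerivAt_integral_inv_mul_translate {G : ℂ × ℂ → ℂ}
    (hG : ContDiff ℝ 1 G) {R : ℝ}
    (hR : ∀ q : ℂ × ℂ, R < ‖q.1‖ → G q = 0) (p : ℂ × ℂ) :
    Integrable (fun w : ℂ => w⁻¹ • fderiv ℝ G (p.1 + w, p.2)) ∧
    HasFDerivAt (fun x : ℂ × ℂ => ∫ w : ℂ, w⁻¹ • G (x.1 + w, x.2))
      (∫ w : ℂ, w⁻¹ • fderiv ℝ G (p.1 + w, p.2)) p := by
  have hDcont : Continuous (fderiv ℝ G) := hG.continuous_fderiv one_ne_zero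
  have hDR : ∀ q : ℂ × ℂ, R < ‖q.1‖ → fderiv ℝ G q = 0 := fun q hq => by
    have : G =ᶠ[nhds q] fun _ => 0 := by
      filter_upwards [(isOpen_lt continuous_const continuous_fst.norm).mem_nhds hq] with y hy
      exact hR y hy
    rw [this.fderiv_eq, fderiv_fun_const]
    rfl
  have meas : ∀ x : ℂ × ℂ, AEStronglyMeasurable fun w : ℂ => w⁻¹ • G (x.1 + w, x.2) := fun x =>
    measurable_inv.aestronglyMeasurable.smul
      (hG.continuous.comp
        (by fun_prop : Continuous fun w : ℂ => (x.1 + w, x.2))).aestronglyMeasurable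
  have measD : AEStronglyMeasurable fun w : ℂ => w⁻¹ • fderiv ℝ G (p.1 + w, p.2) :=
    measurable_inv.aestronglyMeasurable.smul
      (hDcont.comp (by fun_prop : Continuous fun w : ℂ => (p.1 + w, p.2))).aestronglyMeasurable
  obtain ⟨C, S, hC⟩ := exists_norm_inv_smul_translate_le hG.continuous hR p
  obtain ⟨C', S', hC'⟩ := exists_norm_inv_smul_translate_le hDcont hDR p
  have hp : p ∈ Metric.ball p 1 := Metric.mem_ball_self one_pos
  have hderiv : ∀ w : ℂ, ∀ x : ℂ × ℂ, HasFDerivAt (fun x : ℂ × ℂ => w⁻¹ • G (x.1 + w, x.2))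
      (w⁻¹ • fderiv ℝ G (x.1 + w, x.2)) x := fun w x => by
    have h1 : HasFDerivAt (fun x : ℂ × ℂ => (x.1 + w, x.2))
        (ContinuousLinearMap.id ℝ (ℂ × ℂ)) x := by
      rw [← ContinuousLinearMap.fst_prod_snd]
      exact (hasFDerivAt_fst.add_const w).prodMk hasFDerivAt_snd
    have h2 : HasFDerivAt G (fderiv ℝ G (x.1 + w, x.2)) (x.1 + w, x.2) :=
      (hG.differentiable one_ne_zero _).hasFDerivAt
    exact (h2.comp x h1).const_smul w⁻¹
  refine ⟨(integrable_indicator_closedBall_mul_norm_inv C' S').mono' measD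
    (.of_forall (hC' p hp)), ?_⟩
  exact hasFDerivAt_integral_of_dominated_of_fderiv_le (𝕜 := ℝ)
    (F := fun (x : ℂ × ℂ) (w : ℂ) => w⁻¹ • G (x.1 + w, x.2))
    (F' := fun (x : ℂ × ℂ) (w : ℂ) => w⁻¹ • fderiv ℝ G (x.1 + w, x.2))
    (Metric.ball_mem_nhds p one_pos) (.of_forall meas)
    ((integrable_indicator_closedBall_mul_norm_inv C S).mono' (meas p) (.of_forall (hC p hp)))
    measD (.of_forall fun w x hx => hC' x hx w)
    (integrable_indicator_closedBall_mul_norm_inv C' S') (.of_forall fun w x _ => hderiv w x)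

theorem fderiv_apply_snd_of_differentiable {G : ℂ × ℂ → ℂ} {q : ℂ × ℂ}
    (hG : DifferentiableAt ℝ G q) (hol : DifferentiableAt ℂ (fun c => G (q.1, c)) q.2) (c : ℂ) :
    fderiv ℝ G q (0, c) = c * fderiv ℝ G q (0, 1) := by
  have h1 : HasFDerivAt (fun c : ℂ => G (q.1, c))
      ((fderiv ℝ G q).comp (ContinuousLinearMap.inr ℝ ℂ ℂ)) q.2 :=
    hG.hasFDerivAt.comp q.2 (hasFDerivAt_prodMk_right q.1 q.2)
  have h2 := h1.unique (hol.hasFDerivAt.restrictScalars ℝ)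
  have key : ∀ z : ℂ, fderiv ℝ G q (0, z) = z * deriv (fun c => G (q.1, c)) q.2 := fun z => by
    have := DFunLike.congr_fun h2 z
    simpa using this
  rw [key c, key 1, one_mul]

/-- The derivative of the Cauchy transform of `G`, taken in the first variable and with `c` as a
parameter, satisfies `∂_ξ̄ = -π G`, and is complex linear in the parameter direction. -/
theorem exists_hasFDerivAt_integral_inv_mul_translate {G : ℂ × ℂ → ℂ}
    (hG : ContDiff ℝ 1 G) {R : ℝ}
    (hR : ∀ q : ℂ × ℂ, R < ‖q.1‖ → G q = 0)
    (hol : ∀ z : ℂ, Differentiable ℂ fun c : ℂ => G (z, c)) (p : ℂ × ℂ) :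
    ∃ L : ℂ × ℂ →L[ℝ] ℂ,
      HasFDerivAt (fun x : ℂ × ℂ => ∫ w : ℂ, w⁻¹ • G (x.1 + w, x.2)) L p ∧
      (∀ c : ℂ, L (0, c) = c * L (0, 1)) ∧
      (L (1, 0) + I * L (I, 0)) / 2 = -π * G p := by
  obtain ⟨hint, hL⟩ := hasFDerivAt_integral_inv_mul_translate hG hR p
  have hdiff : Differentiable ℝ G := hG.differentiable one_ne_zero
  have happ : ∀ v : ℂ × ℂ, (∫ w : ℂ, w⁻¹ • fderiv ℝ G (p.1 + w, p.2)) v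
      = ∫ w : ℂ, w⁻¹ * fderiv ℝ G (p.1 + w, p.2) v := fun v => by
    rw [ContinuousLinearMap.integral_apply hint]
    rfl
  have hintv : ∀ v : ℂ × ℂ, Integrable fun w : ℂ => w⁻¹ * fderiv ℝ G (p.1 + w, p.2) v :=
    fun v => hint.apply_continuousLinearMap v
  refine ⟨_, hL, fun c => ?_, ?_⟩
  · rw [happ, happ, ← integral_const_mul]
    refine integral_congr_ae (.of_forall fun w => ?_)
    simp only
    rw [fderiv_apply_snd_of_differentiable (hdiff _) (hol _ _) c]
    ring
  · have hg : ContDiff ℝ 1 fun w : ℂ => G (p.1 + w, p.2) := hG.comp (by fun_prop)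
    have hc : HasCompactSupport fun w : ℂ => G (p.1 + w, p.2) := by
      refine HasCompactSupport.intro (isCompact_closedBall (0 : ℂ) (R + ‖p.1‖)) fun w hw => ?_
      refine hR _ ?_
      rw [mem_closedBall_zero_iff, not_le] at hw
      have := norm_sub_le (p.1 + w) p.1
      rw [add_sub_cancel_left] at this
      simp only
      linarith
    have hfd : ∀ w v : ℂ, fderiv ℝ (fun w : ℂ => G (p.1 + w, p.2)) w v
        = fderiv ℝ G (p.1 + w, p.2) (v, 0) := fun w v => by
      have h1 : HasFDerivAt (fun w : ℂ => (p.1 + w, p.2)) (ContinuousLinearMap.inl ℝ ℂ ℂ) w :=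
        ((hasFDerivAt_id (𝕜 := ℝ) w).const_add p.1).prodMk (hasFDerivAt_const p.2 w)
      have h2 : HasFDerivAt G (fderiv ℝ G (p.1 + w, p.2)) (p.1 + w, p.2) := (hdiff _).hasFDerivAt
      exact DFunLike.congr_fun (h2.comp w h1).fderiv v
    have := integral_inv_mul_fderiv_wirtinger hg hc
    simp only [hfd, add_zero, Prod.mk.eta] at this
    rw [← this, happ, happ, ← integral_const_mul, ← integral_add (hintv _) ((hintv _).const_mul I),
      ← integral_div]
    refine integral_congr_ae (.of_forall fun w => ?_)
    simp only
    ring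

/-- formula (45f): for `β` independent of `φ`, `χ⁰` with `∂_ξ̄χ⁰ = β̄`,
and `F(ξ′, ·)` holomorphic, compactly supported in `ξ′` and `C¹`, the function
`U(ξ,φ) = (1/2πi)∫ F(ξ′, φ + χ⁰(ξ) − χ⁰(ξ′))/(ξ′−ξ) dξ′∧dξ̄′
        = −(1/π)∫ F(ξ′, φ + χ⁰(ξ) − χ⁰(ξ′))/(ξ′−ξ) dA(ξ′)`
solves `∂_ξ̄U − β̄∂_φU = F(ξ,φ)`. -/
theorem integral_formula_45f_solves_37
    (β : ℂ → ℂ) (hβ : Continuous β)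
    (χ0 : ℂ → ℂ) (hχ0 : ContDiff ℝ 1 χ0)
    (hχ0β : ∀ z : ℂ, dbarC χ0 z = (starRingEnd ℂ) (β z))
    (F : ℂ × ℂ → ℂ) (hF : ContDiff ℝ 1 F)
    (hFsupp : ∃ K : Set ℂ, IsCompact K ∧ ∀ w : ℂ,
      (Function.support fun z : ℂ => F (z, w)) ⊆ K)
    (hFhol : ∀ z : ℂ, Differentiable ℂ (fun w : ℂ => F (z, w)))
    (U : ℂ × ℝ → ℂ)
    (hU : ∀ ξ : ℂ, ∀ φ : ℝ,
      U (ξ, φ) = -(1 / (π : ℂ)) *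
        ∫ w : ℂ, F (w, (φ : ℂ) + χ0 ξ - χ0 w) / (w - ξ)) :
    ∀ p : ℂ × ℝ,
      dbar U p - (starRingEnd ℂ) (β p.1) * dphi U p = F (p.1, (p.2 : ℂ)) := by
  obtain ⟨K, hK, hKF⟩ := hFsupp
  obtain ⟨R, hR⟩ := hK.isBounded.subset_closedBall 0
  set G : ℂ × ℂ → ℂ := fun q => F (q.1, q.2 - χ0 q.1) with hGdef
  have hG : ContDiff ℝ 1 G := hF.comp (by fun_prop)
  have hGR : ∀ q : ℂ × ℂ, R < ‖q.1‖ → G q = 0 := fun q hq => by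
    by_contra h
    have := hR (hKF (q.2 - χ0 q.1) h)
    rw [mem_closedBall_zero_iff] at this
    linarith
  have hGhol : ∀ z : ℂ, Differentiable ℂ fun c : ℂ => G (z, c) := fun z =>
    (hFhol z).comp (differentiable_id.sub_const (χ0 z))
  rintro ⟨ξ, φ⟩
  obtain ⟨L, hL, hLc, hLbar⟩ :=
    exists_hasFDerivAt_integral_inv_mul_translate hG hGR hGhol (ξ, φ + χ0 ξ)
  have hUG : ∀ ζ : ℂ, ∀ s : ℝ,
      U (ζ, s) = -(1 / (π : ℂ)) * ∫ w : ℂ, w⁻¹ • G (ζ + w, s + χ0 ζ) := fun ζ s => by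
    rw [hU, ← integral_add_left_eq_self _ ζ]
    congr 2 with w
    simp only [hGdef, add_sub_cancel_left, smul_eq_mul]
    rw [div_eq_inv_mul]
  have hχ : ∀ v : ℂ, HasDerivAt (fun t : ℝ => χ0 (ξ + t * v)) (fderiv ℝ χ0 ξ v) 0 := fun v => by
    have h1 : HasDerivAt (fun t : ℝ => ξ + t * v) v 0 := by
      simpa using ((Complex.ofRealCLM.hasDerivAt (x := (0 : ℝ))).mul_const v).const_add ξ
    have h2 : HasFDerivAt χ0 (fderiv ℝ χ0 ξ) (ξ + ((0 : ℝ) : ℂ) * v) := by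
      simpa using (hχ0.differentiable one_ne_zero ξ).hasFDerivAt
    exact h2.comp_hasDerivAt 0 h1
  have hLadd : ∀ v c : ℂ, L (v, c) = L (v, 0) + c * L (0, 1) := fun v c => by
    rw [← hLc c, ← map_add]; simp
  have hx : ∀ v : ℂ, HasDerivAt (fun t : ℝ => U (ξ + t * v, φ))
      (-(1 / (π : ℂ)) * (L (v, 0) + fderiv ℝ χ0 ξ v * L (0, 1))) 0 := fun v => by
    have h1 : HasDerivAt (fun t : ℝ => (ξ + t * v, (φ : ℂ) + χ0 (ξ + t * v)))
        (v, fderiv ℝ χ0 ξ v) 0 := by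
      refine HasDerivAt.prodMk ?_ ((hχ v).const_add (φ : ℂ))
      simpa using ((Complex.ofRealCLM.hasDerivAt (x := (0 : ℝ))).mul_const v).const_add ξ
    have h2 := (HasFDerivAt.comp_hasDerivAt_of_eq 0 hL h1 (by simp)).const_mul (-(1 / (π : ℂ)))
    rw [hLadd] at h2
    simp only [hUG]
    exact h2
  have hφ : HasDerivAt (fun s : ℝ => U (ξ, s)) (-(1 / (π : ℂ)) * L (0, 1)) φ := by
    have h1 : HasDerivAt (fun s : ℝ => (ξ, (s : ℂ) + χ0 ξ)) ((0 : ℂ), (1 : ℂ)) φ :=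
      (hasDerivAt_const φ ξ).prodMk
        ((Complex.ofRealCLM.hasDerivAt (x := φ)).add_const (χ0 ξ))
    have h2 := (HasFDerivAt.comp_hasDerivAt_of_eq φ hL h1 rfl).const_mul (-(1 / (π : ℂ)))
    simp only [hUG]
    exact h2
  have hβξ := hχ0β ξ
  have hχ1 := hχ 1
  have hx1 := hx 1
  simp only [mul_one] at hχ1 hx1
  rw [dbarC, hχ1.deriv, (hχ I).deriv] at hβξ
  rw [dbar, dx1, dx2, dphi]
  simp only
  rw [hx1.deriv, (hx I).deriv, hφ.deriv, ← hβξ]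
  have hπ : (π : ℂ) ≠ 0 := by exact_mod_cast Real.pi_ne_zero
  have hGF : G (ξ, φ + χ0 ξ) = F (ξ, φ) := by simp [hGdef]
  rw [hGF] at hLbar
  calc _ = -(1 / (π : ℂ)) * ((L (1, 0) + I * L (I, 0)) / 2) := by ring
    _ = F (ξ, φ) := by rw [hLbar]; field_simp
end

section
/- Let ρ, α : ℂ × ℝ → ℝ and β, V, W, U : ℂ × ℝ → ℂ (with W real-valued) be continuously differentiable functions of (ξ, φ), ξ = x¹ + ix², with ρ, α > 0, and let ε = ±1. Define E[ρ,α,β,V] = 2ρα⁻¹ Re(∂̄V − 2β̄_{,φ}V) and F[ρ,α,β,V,W] = −½ρ²α⁻² ∂(α³W) + (3/2)ρ²αW β_{,φ} − 2i Im(∂̄β) V − ½ ∂_φ(α⁻²ρ²V), where ∂ = ∂_ξ − β∂_φ, ∂̄ = ∂_ξ̄ − β̄∂_φ, ∂_ξ = ½(∂_{x¹} − i∂_{x²}), ∂_ξ̄ = ½(∂_{x¹} + i∂_{x²}). Let σ(ξ, φ) = (−ξ̄, φ) be the reflection x¹ → −x¹, and define the transformed fields ρ′ = ρ∘σ, α′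 = α∘σ, β′ = −β̄∘σ, V′ = −ε V̄∘σ, W′ = ε W∘σ, U′ = ε Ū∘σ. If W and U satisfy ∂_φ(ρ³W) = E[ρ,α,β,V] and ∂_ξ̄U − ∂_φ(β̄U) = F[ρ,α,β,V,W], then W′ and U′ satisfy ∂_φ(ρ′³W′) = E[ρ′,α′,β′,V′] and ∂_ξ̄U′ − ∂_φ(β̄′U′) = F[ρ′,α′,β′,V′,W′]. -/
open Complex

/-- Wirtinger derivative `∂_ξ = ½(∂_{x¹} − i ∂_{x²})`. -/
noncomputable def dz (f : ℂ × ℝ → ℂ) (p : ℂ × ℝ) : ℂ :=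
  (dx1 f p - Complex.I * dx2 f p) / 2

/-- The operator `∂̄ = ∂_ξ̄ − β̄ ∂_φ` applied to `f`. -/
noncomputable def dbarOp (β f : ℂ × ℝ → ℂ) (p : ℂ × ℝ) : ℂ :=
  dbar f p - (starRingEnd ℂ) (β p) * dphi f p

/-- The operator `∂ = ∂_ξ − β ∂_φ` applied to `f`. -/
noncomputable def dOp (β f : ℂ × ℝ → ℂ) (p : ℂ × ℝ) : ℂ :=
  dz f p - β p * dphi f p

/-- The source `E[ρ,α,β,V] = 2ρα⁻¹ Re(∂̄V − 2β̄_{,φ}V)` of equation (39b), cf. (39c). -/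
noncomputable def Efun (ρ α : ℂ × ℝ → ℝ) (β V : ℂ × ℝ → ℂ) (p : ℂ × ℝ) : ℝ :=
  2 * ρ p / α p *
    (dbarOp β V p - 2 * dphi (fun q => (starRingEnd ℂ) (β q)) p * V p).re

/-- The source `F[ρ,α,β,V,W] = −½ρ²α⁻²∂(α³W) + (3/2)ρ²αWβ_{,φ} − 2i Im(∂̄β)V
− ½∂_φ(α⁻²ρ²V)` of equation (37), cf. (39a). -/
noncomputable def Ffun (ρ α : ℂ × ℝ → ℝ) (β V W : ℂ × ℝ → ℂ) (p : ℂ × ℝ) : ℂ :=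
  -(1 / 2) * ((ρ p : ℂ) ^ 2 / (α p : ℂ) ^ 2) * dOp β (fun q => (α q : ℂ) ^ 3 * W q) p
    + (3 / 2) * (ρ p : ℂ) ^ 2 * (α p : ℂ) * W p * dphi β p
    - 2 * Complex.I * (((dbarOp β β p).im : ℝ) : ℂ) * V p
    - (1 / 2) * dphi (fun q => (ρ q : ℂ) ^ 2 / (α q : ℂ) ^ 2 * V q) p

section Reflection

variable {c : ℂ} {σ : ℂ × ℝ → ℂ × ℝ} {f g : ℂ × ℝ → ℂ}

theorem deriv_const_mul_conj (c : ℂ) (h : ℝ → ℂ) (t : ℝ) :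
    deriv (fun s => c * (starRingEnd ℂ) (h s)) t = c * (starRingEnd ℂ) (deriv h t) := by
  rw [deriv_const_mul_field]
  exact congrArg (c * ·) deriv.star

theorem dphi_reflect (hσ : ∀ p : ℂ × ℝ, σ p = (-(starRingEnd ℂ) p.1, p.2))
    (hg : ∀ p, g p = c * (starRingEnd ℂ) (f (σ p))) (p : ℂ × ℝ) :
    dphi g p = c * (starRingEnd ℂ) (dphi f (σ p)) := by
  simp only [dphi, hg, hσ]
  exact deriv_const_mul_conj c _ _

theorem dx1_reflect (hσ : ∀ p : ℂ × ℝ, σ p = (-(starRingEnd ℂ) p.1, p.2))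
    (hg : ∀ p, g p = c * (starRingEnd ℂ) (f (σ p))) (p : ℂ × ℝ) :
    dx1 g p = -(c * (starRingEnd ℂ) (dx1 f (σ p))) := by
  have key : (fun t : ℝ => g (p.1 + (t : ℂ), p.2)) = fun t : ℝ =>
      (fun s : ℝ => c * (starRingEnd ℂ) (f ((σ p).1 + (s : ℂ), (σ p).2))) (-t) := by
    funext t
    simp only [hg, hσ, map_add, conj_ofReal, ofReal_neg, neg_add]
  rw [dx1, key, deriv_comp_neg (fun s : ℝ =>
    c * (starRingEnd ℂ) (f ((σ p).1 + (s : ℂ), (σ p).2))) 0, neg_zero, deriv_const_mul_conj, dx1]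

theorem dx2_reflect (hσ : ∀ p : ℂ × ℝ, σ p = (-(starRingEnd ℂ) p.1, p.2))
    (hg : ∀ p, g p = c * (starRingEnd ℂ) (f (σ p))) (p : ℂ × ℝ) :
    dx2 g p = c * (starRingEnd ℂ) (dx2 f (σ p)) := by
  have key : (fun t : ℝ => g (p.1 + (t : ℂ) * I, p.2)) = fun t : ℝ =>
      c * (starRingEnd ℂ) (f ((σ p).1 + (t : ℂ) * I, (σ p).2)) := by
    funext t
    simp only [hg, hσ, map_add, map_mul, conj_ofReal, conj_I, neg_add, mul_neg, neg_neg]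
  rw [dx2, key, deriv_const_mul_conj, dx2]

theorem dbar_reflect (hσ : ∀ p : ℂ × ℝ, σ p = (-(starRingEnd ℂ) p.1, p.2))
    (hg : ∀ p, g p = c * (starRingEnd ℂ) (f (σ p))) (p : ℂ × ℝ) :
    dbar g p = -(c * (starRingEnd ℂ) (dbar f (σ p))) := by
  simp only [dbar, dx1_reflect hσ hg, dx2_reflect hσ hg, map_div₀, map_add, map_mul, conj_I,
    map_ofNat]
  ring

theorem dz_reflect (hσ : ∀ p : ℂ × ℝ, σ p = (-(starRingEnd ℂ) p.1, p.2))
    (hg : ∀ p, g p = c * (starRingEnd ℂ) (f (σ p))) (p : ℂ × ℝ) :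
    dz g p = -(c * (starRingEnd ℂ) (dz f (σ p))) := by
  simp only [dz, dx1_reflect hσ hg, dx2_reflect hσ hg, map_div₀, map_sub, map_mul, conj_I,
    map_ofNat]
  ring

variable {β β' : ℂ × ℝ → ℂ}

theorem dbarOp_reflect (hσ : ∀ p : ℂ × ℝ, σ p = (-(starRingEnd ℂ) p.1, p.2))
    (hβ : ∀ p, β' p = -(starRingEnd ℂ) (β (σ p)))
    (hg : ∀ p, g p = c * (starRingEnd ℂ) (f (σ p))) (p : ℂ × ℝ) :
    dbarOp β' g p = -(c * (starRingEnd ℂ) (dbarOp β f (σ p))) := by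
  simp only [dbarOp, dbar_reflect hσ hg, dphi_reflect hσ hg, hβ, map_sub, map_mul, map_neg]
  ring

theorem dOp_reflect (hσ : ∀ p : ℂ × ℝ, σ p = (-(starRingEnd ℂ) p.1, p.2))
    (hβ : ∀ p, β' p = -(starRingEnd ℂ) (β (σ p)))
    (hg : ∀ p, g p = c * (starRingEnd ℂ) (f (σ p))) (p : ℂ × ℝ) :
    dOp β' g p = -(c * (starRingEnd ℂ) (dOp β f (σ p))) := by
  simp only [dOp, dz_reflect hσ hg, dphi_reflect hσ hg, hβ, map_sub, map_mul]
  ring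

variable {ρ α ρ' α' : ℂ × ℝ → ℝ} {V W V' W' : ℂ × ℝ → ℂ} {ε : ℝ}

theorem Efun_reflect (hσ : ∀ p : ℂ × ℝ, σ p = (-(starRingEnd ℂ) p.1, p.2))
    (hρ : ∀ p, ρ' p = ρ (σ p)) (hα : ∀ p, α' p = α (σ p))
    (hβ : ∀ p, β' p = -(starRingEnd ℂ) (β (σ p)))
    (hV : ∀ p, V' p = -(ε : ℂ) * (starRingEnd ℂ) (V (σ p))) (p : ℂ × ℝ) :
    Efun ρ' α' β' V' p = ε * Efun ρ α β V (σ p) := by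
  have hβc : ∀ p, (starRingEnd ℂ) (β' p) =
      (-1) * (starRingEnd ℂ) ((starRingEnd ℂ) (β (σ p))) := fun p => by
    rw [hβ, map_neg, neg_one_mul]
  have key : dbarOp β' V' p - 2 * dphi (fun q => (starRingEnd ℂ) (β' q)) p * V' p =
      (ε : ℂ) * (starRingEnd ℂ) (dbarOp β V (σ p) -
        2 * dphi (fun q => (starRingEnd ℂ) (β q)) (σ p) * V (σ p)) := by
    rw [dbarOp_reflect hσ hβ hV,
      dphi_reflect (f := fun q => (starRingEnd ℂ) (β q)) hσ hβc, hV]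
    simp only [map_sub, map_mul, map_ofNat]
    ring
  rw [Efun, Efun, key, re_ofReal_mul, conj_re, hρ, hα]
  ring

theorem Ffun_reflect (hσ : ∀ p : ℂ × ℝ, σ p = (-(starRingEnd ℂ) p.1, p.2))
    (hρ : ∀ p, ρ' p = ρ (σ p)) (hα : ∀ p, α' p = α (σ p))
    (hβ : ∀ p, β' p = -(starRingEnd ℂ) (β (σ p)))
    (hV : ∀ p, V' p = -(ε : ℂ) * (starRingEnd ℂ) (V (σ p)))
    (hW : ∀ p, W' p = (ε : ℂ) * (starRingEnd ℂ) (W (σ p))) (p : ℂ × ℝ) :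
    Ffun ρ' α' β' V' W' p = -((ε : ℂ) * (starRingEnd ℂ) (Ffun ρ α β V W (σ p))) := by
  have hβ₁ : ∀ p, β' p = (-1) * (starRingEnd ℂ) (β (σ p)) := fun p => by
    rw [hβ, neg_one_mul]
  have hαW : ∀ p, (α' p : ℂ) ^ 3 * W' p =
      (ε : ℂ) * (starRingEnd ℂ) ((α (σ p) : ℂ) ^ 3 * W (σ p)) := fun p => by
    simp only [hα, hW, map_mul, map_pow, conj_ofReal]
    ring
  have hρV : ∀ p, (ρ' p : ℂ) ^ 2 / (α' p : ℂ) ^ 2 * V' p = -(ε : ℂ) *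
      (starRingEnd ℂ) ((ρ (σ p) : ℂ) ^ 2 / (α (σ p) : ℂ) ^ 2 * V (σ p)) := fun p => by
    simp only [hρ, hα, hV, map_mul, map_div₀, map_pow, conj_ofReal]
    ring
  simp only [Ffun]
  rw [dOp_reflect (f := fun q => (α q : ℂ) ^ 3 * W q) hσ hβ hαW, dphi_reflect hσ hβ₁,
    dbarOp_reflect hσ hβ hβ₁,
    dphi_reflect (f := fun q => (ρ q : ℂ) ^ 2 / (α q : ℂ) ^ 2 * V q) hσ hρV,
    hρ, hα, hV, hW]
  simp only [neg_one_mul, neg_neg, conj_im, ofReal_neg, map_sub, map_add, map_mul, map_div₀,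
    map_pow, map_neg, map_one, map_ofNat, conj_ofReal, conj_I]
  ring

end Reflection

/-- Proposition 3.1(i): equations (39b) and (37) are compatible with the
reflection `x¹ → −x¹` (`ξ → −ξ̄`) together with the transformations (51g)–(51h):
`ρ → ρ∘σ`, `α → α∘σ`, `β → −β̄∘σ`, `V → −εV̄∘σ`, `W → εW∘σ`, `U → εŪ∘σ`, `ε = ±1`. -/
theorem reflection_covariance_of_39b_and_37
    (ρ α : ℂ × ℝ → ℝ) (β V W U : ℂ × ℝ → ℂ) (ε : ℝ)
    (hε : ε = 1 ∨ ε = -1)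
    (hρ : ContDiff ℝ 1 ρ) (hα : ContDiff ℝ 1 α) (hβ : ContDiff ℝ 1 β)
    (hV : ContDiff ℝ 1 V) (hW : ContDiff ℝ 1 W) (hU : ContDiff ℝ 1 U)
    (hρpos : ∀ p, 0 < ρ p) (hαpos : ∀ p, 0 < α p)
    (hWreal : ∀ p, (W p).im = 0)
    (σ : ℂ × ℝ → ℂ × ℝ) (hσ : ∀ p : ℂ × ℝ, σ p = (-(starRingEnd ℂ) p.1, p.2))
    (ρ' α' : ℂ × ℝ → ℝ) (β' V' W' U' : ℂ × ℝ → ℂ)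
    (hρ' : ∀ p, ρ' p = ρ (σ p)) (hα' : ∀ p, α' p = α (σ p))
    (hβ' : ∀ p, β' p = -(starRingEnd ℂ) (β (σ p)))
    (hV' : ∀ p, V' p = -(ε : ℂ) * (starRingEnd ℂ) (V (σ p)))
    (hW' : ∀ p, W' p = (ε : ℂ) * W (σ p))
    (hU' : ∀ p, U' p = (ε : ℂ) * (starRingEnd ℂ) (U (σ p)))
    (heqW : ∀ p : ℂ × ℝ,
      dphi (fun q => (ρ q : ℂ) ^ 3 * W q) p = ((Efun ρ α β V p : ℝ) : ℂ))
    (heqU : ∀ p : ℂ × ℝ,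
      dbar U p - dphi (fun q => (starRingEnd ℂ) (β q) * U q) p = Ffun ρ α β V W p) :
    (∀ p : ℂ × ℝ,
      dphi (fun q => (ρ' q : ℂ) ^ 3 * W' q) p = ((Efun ρ' α' β' V' p : ℝ) : ℂ))
    ∧ (∀ p : ℂ × ℝ,
      dbar U' p - dphi (fun q => (starRingEnd ℂ) (β' q) * U' q) p
        = Ffun ρ' α' β' V' W' p) := by
  have hWc : ∀ p, W' p = (ε : ℂ) * (starRingEnd ℂ) (W (σ p)) := fun p => by
    rw [hW', conj_eq_iff_im.mpr (hWreal _)]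
  constructor
  · intro p
    have hρW : ∀ p, (ρ' p : ℂ) ^ 3 * W' p =
        (ε : ℂ) * (starRingEnd ℂ) ((ρ (σ p) : ℂ) ^ 3 * W (σ p)) := fun p => by
      simp only [hρ', hWc, map_mul, map_pow, conj_ofReal]
      ring
    rw [dphi_reflect (f := fun q => (ρ q : ℂ) ^ 3 * W q) hσ hρW, heqW, conj_ofReal,
      Efun_reflect hσ hρ' hα' hβ' hV', ofReal_mul]
  · intro p
    have hβU : ∀ p, (starRingEnd ℂ) (β' p) * U' p = -(ε : ℂ) *
        (starRingEnd ℂ) ((starRingEnd ℂ) (β (σ p)) * U (σ p)) := fun p => by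
      simp only [hβ', hU', map_mul, map_neg]
      ring
    rw [dbar_reflect hσ hU', dphi_reflect (f := fun q => (starRingEnd ℂ) (β q) * U q) hσ hβU,
      Ffun_reflect hσ hρ' hα' hβ' hV' hWc, ← heqU, map_sub]
    ring
end
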